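/- Let μ be a triangular regular Borel probability measure on ℝ^N. Then the quantile process Q^μ is strictly triangular increasing, and it is the unique triangular increasing map pushing λ^N to μ: any Borel triangular increasing Q : (0,1)^N → ℝ^N with Q_# λ^N = μ coincides with Q^μ λ^N-almost everywhere. -/

import Mathlib

open MeasureTheory ProbabilityTheory Filter Set
open scoped ENNReal NNReal Topology

/-- Lebesgue measure on `(0,1)`. -/
noncomputable def lambda01 : Measure ℝ := volume.restrict (Set.Ioo (0:ℝ) 1)

/-- The `N`-fold product of Lebesgue measure on `(0,1)`. -/
noncomputable def lambdaN (N : ℕ) : Measure (Fin N → ℝ) :=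
  Measure.pi fun _ => lambda01

/-- The open unit cube `(0,1)^N`. -/
def cube (N : ℕ) : Set (Fin N → ℝ) := {u | ∀ i, u i ∈ Set.Ioo (0:ℝ) 1}

/-- A map is triangular (adapted) if its `k`-th component depends only on the first `k`
coordinates. -/
def Triangular {N : ℕ} (Q : (Fin N → ℝ) → Fin N → ℝ) : Prop :=
  ∀ (k : Fin N) (u v : Fin N → ℝ), (∀ j ≤ k, u j = v j) → Q u k = Q v k

/-- Monotonicity condition (inc) on a set `s`: the `k`-th component is increasing in the
`k`-th coordinate (the earlier coordinates being fixed). -/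
def IncOn {N : ℕ} (Q : (Fin N → ℝ) → Fin N → ℝ) (s : Set (Fin N → ℝ)) : Prop :=
  ∀ k : Fin N, ∀ u ∈ s, ∀ v ∈ s, (∀ j < k, u j = v j) → u k ≤ v k → Q u k ≤ Q v k

/-- Strict monotonicity condition (sinc) on a set `s`. -/
def StrictIncOn {N : ℕ} (Q : (Fin N → ℝ) → Fin N → ℝ) (s : Set (Fin N → ℝ)) : Prop :=
  ∀ k : Fin N, ∀ u ∈ s, ∀ v ∈ s, (∀ j < k, u j = v j) → u k < v k → Q u k < Q v k

/-- Consistency condition (con) on a set `s`: if changing only the `k`-th coordinate does not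
change the `k`-th component, then it does not change any later component `m ≥ k`. -/
def ConOn {N : ℕ} (Q : (Fin N → ℝ) → Fin N → ℝ) (s : Set (Fin N → ℝ)) : Prop :=
  ∀ k m : Fin N, k ≤ m → ∀ u ∈ s, ∀ v ∈ s, (∀ j ≠ k, u j = v j) →
    Q u k = Q v k → Q u m = Q v m

/-- A quantile process: a Borel triangular map satisfying (inc) and (con) on the unit cube. -/
structure IsQuantileProcess {N : ℕ} (Q : (Fin N → ℝ) → Fin N → ℝ) : Prop where
  measurable : Measurable Q
  triangular : Triangular Q
  inc : IncOn Q (cube N)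
  con : ConOn Q (cube N)

/-- The (a.e. unique) quantile process of `μ`, chosen via Hilbert's epsilon operator. -/
noncomputable def quantileProcess {N : ℕ} (μ : Measure (Fin N → ℝ)) :
    (Fin N → ℝ) → Fin N → ℝ :=
  Classical.epsilon fun Q => IsQuantileProcess Q ∧ (lambdaN N).map Q = μ

/-- An increasing triangular transformation: a Borel triangular map satisfying (inc) on a
`λ^N`-full subset of the unit cube. -/
def IncreasingTriangular {N : ℕ} (T : (Fin N → ℝ) → Fin N → ℝ) : Prop :=
  Measurable T ∧ Triangular T ∧
    ∃ Γ : Set (Fin N → ℝ), Γ ⊆ cube N ∧ lambdaN N Γᶜ = 0 ∧ IncOn T Γ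

/-- A strictly increasing triangular transformation: a Borel triangular map satisfying (sinc)
on a `λ^N`-full subset of the unit cube. -/
def StrictlyIncreasingTriangular {N : ℕ} (T : (Fin N → ℝ) → Fin N → ℝ) : Prop :=
  Measurable T ∧ Triangular T ∧
    ∃ Γ : Set (Fin N → ℝ), Γ ⊆ cube N ∧ lambdaN N Γᶜ = 0 ∧ StrictIncOn T Γ

/-- `κ` is a disintegration (regular conditional law) of `ρ` w.r.t. its first coordinate. -/
def Disintegrates {α β : Type*} [MeasurableSpace α] [MeasurableSpace β]
    (ρ : Measure (α × β)) (κ : Kernel α β) : Prop :=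
  ∀ (A : Set α) (B : Set β), MeasurableSet A → MeasurableSet B →
    ρ (A ×ˢ B) = ∫⁻ a in A, κ a B ∂(ρ.map Prod.fst)

/-- The first `k` coordinates of `x : ℝ^N`. -/
def restr {N : ℕ} (k : Fin N) (x : Fin N → ℝ) : Fin (k : ℕ) → ℝ :=
  fun j => x ⟨j, j.isLt.trans k.isLt⟩

/-- `μ` is triangular regular: for every `k` the conditional law of `x_k` given
`x_{1:k-1}` under `μ` is a.s. atomless. -/
def TriangularRegular {N : ℕ} (μ : Measure (Fin N → ℝ)) : Prop :=
  ∀ k : Fin N, ∃ κ : Kernel (Fin (k : ℕ) → ℝ) ℝ, IsMarkovKernel κ ∧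
    Disintegrates (μ.map fun x => (restr k x, x k)) κ ∧
    ∀ᵐ a ∂(μ.map (restr k)), ∀ x : ℝ, (κ a) {x} = 0

instance : IsProbabilityMeasure lambda01 :=
  ⟨by simp [lambda01]⟩

instance (N : ℕ) : IsProbabilityMeasure (lambdaN N) := by
  unfold lambdaN; infer_instance

lemma ae_lambda01_mem : ∀ᵐ t ∂lambda01, t ∈ Ioo (0 : ℝ) 1 :=
  ae_restrict_mem measurableSet_Ioo

lemma lambdaN_map_reindex {m n : ℕ} {e : Fin m → Fin n} (he : Function.Injective e) :
    (lambdaN n).map (fun u i => u (e i)) = lambdaN m := by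
  have h : iIndepFun (fun (i : Fin n) (u : Fin n → ℝ) => u i) (lambdaN n) :=
    iIndepFun_pi (μ := fun _ => lambda01) (X := fun _ => id) fun _ => aemeasurable_id
  have h' := (iIndepFun_iff_map_fun_eq_pi_map
    (fun i => (measurable_pi_apply (e i)).aemeasurable)).1 (h.precomp he)
  rw [h', lambdaN]
  congr 1
  ext1 i
  exact (measurePreserving_eval (fun _ : Fin n => lambda01) (e i)).map_eq

lemma ae_mem_cube (N : ℕ) : ∀ᵐ u ∂lambdaN N, u ∈ cube N := by
  rw [cube]
  refine ae_all_iff.2 fun i => ?_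
  have h := (measurePreserving_eval (fun _ : Fin N => lambda01) i)
  exact h.quasiMeasurePreserving.ae ae_lambda01_mem

lemma measurable_update_prod {N : ℕ} (k : Fin N) :
    Measurable fun p : (Fin N → ℝ) × ℝ => Function.update p.1 k p.2 := by
  refine measurable_pi_lambda _ fun j => ?_
  by_cases h : j = k
  · subst h; simpa using measurable_snd
  · simpa [h] using measurable_fst.eval

lemma lambdaN_map_update {N : ℕ} (k : Fin N) :
    ((lambdaN N).prod lambda01).map (fun p => Function.update p.1 k p.2) = lambdaN N := by
  symm
  refine Measure.pi_eq fun s hs => ?_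
  have hpre : (fun p : (Fin N → ℝ) × ℝ => Function.update p.1 k p.2) ⁻¹' univ.pi s =
      (univ.pi (Function.update s k univ)) ×ˢ s k := by
    ext ⟨u, t⟩
    simp only [mem_preimage, Set.mem_pi, mem_univ, true_implies, mem_prod]
    constructor
    · intro h
      refine ⟨fun i => ?_, by simpa using h k⟩
      by_cases hi : i = k
      · subst hi; simp
      · simpa [hi] using h i
    · rintro ⟨h, ht⟩ i
      by_cases hi : i = k
      · subst hi; simpa using ht
      · simpa [hi] using h i
  rw [Measure.map_apply (measurable_update_prod k) (MeasurableSet.univ_pi hs), hpre,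
    Measure.prod_prod, lambdaN, Measure.pi_pi,
    ← Finset.mul_prod_erase _ _ (Finset.mem_univ k),
    ← Finset.mul_prod_erase Finset.univ (fun i => lambda01 (s i)) (Finset.mem_univ k)]
  simp only [Function.update_self, measure_univ, one_mul]
  rw [mul_comm]
  congr 1
  refine Finset.prod_congr rfl fun i hi => ?_
  rw [Function.update_of_ne (Finset.ne_of_mem_erase hi)]

lemma measurable_restr {N : ℕ} (k : Fin N) : Measurable (restr k) :=
  measurable_pi_lambda _ fun _ => measurable_pi_apply _

lemma lambdaN_map_restr {N : ℕ} (k : Fin N) : (lambdaN N).map (restr k) = lambdaN k :=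
  lambdaN_map_reindex (e := fun j : Fin (k : ℕ) => (⟨j, j.isLt.trans k.isLt⟩ : Fin N))
    fun _ _ h => Fin.ext (by simpa using h)

lemma restr_update {N : ℕ} (k : Fin N) (u : Fin N → ℝ) (t : ℝ) :
    restr k (Function.update u k t) = restr k u := by
  ext j
  exact Function.update_of_ne (Fin.ne_of_lt j.isLt) _ _

lemma lambdaN_map_restr_prod {N : ℕ} (k : Fin N) :
    (lambdaN N).map (fun u => (restr k u, u k)) = (lambdaN k).prod lambda01 := by
  conv_lhs => rw [← lambdaN_map_update k]
  rw [Measure.map_map ((measurable_restr k).prodMk (measurable_pi_apply k))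
    (measurable_update_prod k)]
  have : (fun u => (restr k u, u k)) ∘ (fun p : (Fin N → ℝ) × ℝ => Function.update p.1 k p.2) =
      Prod.map (restr k) id := by
    ext1 p
    simp [restr_update, Prod.map]
  rw [this, ← Measure.map_prod_map _ _ (measurable_restr k) measurable_id, Measure.map_id,
    lambdaN_map_restr]

/-- A point of `ℝ^N` whose first `k` coordinates are `a` and whose `k`-th coordinate is `t`. -/
noncomputable def extendPoint {N : ℕ} (k : Fin N) (a : Fin (k : ℕ) → ℝ) (t : ℝ) : Fin N → ℝ :=
  fun j => if h : j < k then a ⟨j, h⟩ else if j = k then t else 1 / 2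

lemma measurable_extendPoint {N : ℕ} (k : Fin N) :
    Measurable fun p : (Fin (k : ℕ) → ℝ) × ℝ => extendPoint k p.1 p.2 := by
  refine measurable_pi_lambda _ fun j => ?_
  unfold extendPoint
  split_ifs
  · exact (measurable_pi_apply _).comp measurable_fst
  · exact measurable_snd
  · exact measurable_const

lemma extendPoint_of_lt {N : ℕ} {k j : Fin N} (h : j < k) (a : Fin (k : ℕ) → ℝ) (t : ℝ) :
    extendPoint k a t j = a ⟨j, h⟩ := by
  simp [extendPoint, h]

@[simp] lemma extendPoint_self {N : ℕ} (k : Fin N) (a : Fin (k : ℕ) → ℝ) (t : ℝ) :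
    extendPoint k a t k = t := by
  simp [extendPoint]

@[simp] lemma restr_extendPoint {N : ℕ} (k : Fin N) (a : Fin (k : ℕ) → ℝ) (t : ℝ) :
    restr k (extendPoint k a t) = a := by
  ext j
  exact extendPoint_of_lt (k := k) (j := ⟨j, j.isLt.trans k.isLt⟩) j.isLt a t

lemma extendPoint_mem_cube {N : ℕ} {k : Fin N} {a : Fin (k : ℕ) → ℝ} {t : ℝ} (ha : a ∈ cube k)
    (ht : t ∈ Ioo (0 : ℝ) 1) : extendPoint k a t ∈ cube N := by
  intro j
  unfold extendPoint
  split_ifs with h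
  · exact ha _
  · exact ht
  · norm_num

lemma restr_mem_cube {N : ℕ} (k : Fin N) {u : Fin N → ℝ} (hu : u ∈ cube N) :
    restr k u ∈ cube k := fun _ => hu _

lemma extendPoint_restr_of_le {N : ℕ} {k j : Fin N} (h : j ≤ k) (u : Fin N → ℝ) :
    extendPoint k (restr k u) (u k) j = u j := by
  rcases h.lt_or_eq with h | rfl
  · exact extendPoint_of_lt h _ _
  · simp

/-- The `k`-th component of a triangular map, as a function of the first `k` coordinates and of
the `k`-th one. -/
noncomputable def component {N : ℕ} (T : (Fin N → ℝ) → Fin N → ℝ) (k : Fin N)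
    (p : (Fin (k : ℕ) → ℝ) × ℝ) : ℝ :=
  T (extendPoint k p.1 p.2) k

/-- The components of a triangular map preceding the `k`-th one, as a function of the first `k`
coordinates. -/
noncomputable def head {N : ℕ} (T : (Fin N → ℝ) → Fin N → ℝ) (k : Fin N)
    (a : Fin (k : ℕ) → ℝ) : Fin (k : ℕ) → ℝ :=
  restr k (T (extendPoint k a (1 / 2)))

section

variable {N : ℕ} {T : (Fin N → ℝ) → Fin N → ℝ}

lemma measurable_component (hT : Measurable T) (k : Fin N) : Measurable (component T k) :=
  (measurable_pi_apply k).comp (hT.comp (measurable_extendPoint k))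

lemma measurable_head (hT : Measurable T) (k : Fin N) : Measurable (head T k) :=
  (measurable_restr k).comp (hT.comp ((measurable_extendPoint k).comp
    (measurable_id.prodMk measurable_const)))

lemma Triangular.component_restr (hT : Triangular T) (k : Fin N) (u : Fin N → ℝ) :
    component T k (restr k u, u k) = T u k :=
  hT k _ _ fun _ hj => extendPoint_restr_of_le hj u

lemma Triangular.component_restr_update (hT : Triangular T) (k : Fin N) (u : Fin N → ℝ) (t : ℝ) :
    component T k (restr k u, t) = T (Function.update u k t) k := by
  have h := hT.component_restr k (Function.update u k t)
  rwa [restr_update, Function.update_self] at h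

lemma Triangular.head_restr (hT : Triangular T) (k : Fin N) (u : Fin N → ℝ) :
    head T k (restr k u) = restr k (T u) := by
  ext j
  refine hT _ _ _ fun i hi => ?_
  have hik : i < k := lt_of_le_of_lt hi j.isLt
  rw [extendPoint_of_lt hik]
  rfl

end

/-- If `h` is injective on a full set, the conditional law of `f (a, ·)` given `h a` is the law of
`f (a, ·)`. -/
lemma ae_map_eq_of_disintegrates_of_injOn {α β : Type*} [MeasurableSpace α]
    [StandardBorelSpace α] [MeasurableSpace β] [MeasurableSpace.CountablySeparated β]
    {P : Measure α} [IsProbabilityMeasure P] {ν : Measure ℝ} [IsProbabilityMeasure ν]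
    {h : α → β} (hh : Measurable h) {f : α × ℝ → ℝ} (hf : Measurable f)
    {κ : Kernel β ℝ} [IsMarkovKernel κ]
    (hκ : Disintegrates ((P.prod ν).map fun p => (h p.1, f p)) κ)
    {S : Set α} (hS : ∀ᵐ a ∂P, a ∈ S) (hinj : InjOn h S) :
    ∀ᵐ a ∂P, ν.map (fun t => f (a, t)) = κ (h a) := by
  let η : Kernel α ℝ := (Kernel.id ×ₖ Kernel.const α ν).map f
  have : IsMarkovKernel η := Kernel.IsMarkovKernel.map _ hf
  have hη : ∀ a, η a = ν.map (fun t => f (a, t)) := by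
    intro a
    rw [Kernel.map_apply _ hf, Kernel.prod_apply, Kernel.id_apply, Kernel.const_apply,
      Measure.dirac_prod, Measure.map_map hf measurable_prodMk_left]
    rfl
  have hpair : Measurable fun p : α × ℝ => (h p.1, f p) := (hh.comp measurable_fst).prodMk hf
  obtain ⟨S₀, hS₀S, hS₀, hS₀P⟩ : ∃ S₀ ⊆ S, MeasurableSet S₀ ∧ ∀ᵐ a ∂P, a ∈ S₀ := by
    refine ⟨(toMeasurable P Sᶜ)ᶜ, ?_, (measurableSet_toMeasurable _ _).compl, ?_⟩
    · exact compl_subset_comm.1 (subset_toMeasurable P Sᶜ)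
    · rw [ae_iff]
      simpa [measure_toMeasurable] using show P Sᶜ = 0 from hS
  have key : P ⊗ₘ η = P ⊗ₘ (κ.comap h hh) := by
    refine Measure.ext_prod fun {A B} hA hB => ?_
    rw [Measure.compProd_apply_prod hA hB, Measure.compProd_apply_prod hA hB]
    set A' : Set β := h '' (A ∩ S₀)
    have hA'm : MeasurableSet A' := (hA.inter hS₀).image_of_measurable_injOn hh
      (hinj.mono (inter_subset_right.trans hS₀S))
    have hAA' : ∀ a ∈ S₀, (h a ∈ A' ↔ a ∈ A) := by
      intro a ha
      constructor
      · rintro ⟨b, ⟨hb, hbS⟩, hba⟩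
        rwa [← hinj (hS₀S hbS) (hS₀S ha) hba]
      · exact fun h' => ⟨a, ⟨h', ha⟩, rfl⟩
    have hAe : (h ⁻¹' A' : Set α) =ᵐ[P] A := by
      filter_upwards [hS₀P] with a ha
      exact propext (hAA' a ha)
    have h1 := hκ A' B hA'm hB
    rw [Measure.map_map measurable_fst hpair, Measure.map_apply hpair (hA'm.prod hB)] at h1
    have hfst : (P.prod ν).map (Prod.fst ∘ fun p : α × ℝ => (h p.1, f p)) = P.map h := by
      change (P.prod ν).map (h ∘ Prod.fst) = _
      rw [← Measure.map_map hh measurable_fst]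
      congr 1
      simp
    rw [hfst, setLIntegral_map hA'm (Kernel.measurable_coe κ hB) hh, setLIntegral_congr hAe] at h1
    rw [show ∫⁻ a in A, (κ.comap h hh) a B ∂P = ∫⁻ a in A, κ (h a) B ∂P from rfl, ← h1,
      ← setLIntegral_congr hAe, Measure.prod_apply (hpair (hA'm.prod hB)),
      ← lintegral_indicator (hh hA'm)]
    refine lintegral_congr fun a => ?_
    by_cases ha : h a ∈ A'
    · rw [indicator_of_mem (show a ∈ h ⁻¹' A' from ha), hη,
        Measure.map_apply (by fun_prop) hB]
      congr 1
      ext t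
      simp [ha]
    · rw [indicator_of_notMem (show a ∉ h ⁻¹' A' from ha)]
      have : Prod.mk a ⁻¹' ((fun p : α × ℝ => (h p.1, f p)) ⁻¹' A' ×ˢ B) = ∅ := by
        ext t
        simp [ha]
      rw [this, measure_empty]
  filter_upwards [Kernel.ae_eq_of_compProd_eq key] with a ha
  rw [← hη, ha, Kernel.comap_apply]

lemma StrictMonoOn.of_map_lambda01_singleton {f : ℝ → ℝ} (hf : Measurable f)
    (hmono : MonotoneOn f (Ioo 0 1)) (hatom : ∀ x, (lambda01.map f) {x} = 0) :
    StrictMonoOn f (Ioo 0 1) := by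
  intro s hs t ht hst
  refine lt_of_le_of_ne (hmono hs ht hst.le) fun heq => ?_
  have h := hatom (f s)
  rw [Measure.map_apply hf (measurableSet_singleton _), lambda01] at h
  have hsub : Ioo s t ⊆ Ioo 0 1 := Ioo_subset_Ioo hs.1.le ht.2.le
  have h2 : (volume.restrict (Ioo (0 : ℝ) 1)) (Ioo s t) = 0 := by
    refine measure_mono_null (fun r hr => ?_) h
    exact le_antisymm (heq ▸ hmono (hsub hr) ht hr.2.le) (hmono hs (hsub hr) hr.1.le)
  rw [Measure.restrict_apply measurableSet_Ioo, inter_eq_left.2 hsub, Real.volume_Ioo,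
    ENNReal.ofReal_eq_zero] at h2
  linarith

lemma ae_le_of_map_eq_of_monotoneOn {ν : Measure ℝ} [IsFiniteMeasure ν] {f g : ℝ → ℝ}
    (hf : Measurable f) (hg : Measurable g) {S : Set ℝ} (hS : ∀ᵐ t ∂ν, t ∈ S)
    (hfS : MonotoneOn f S) (hgS : MonotoneOn g S) (hfg : ν.map f = ν.map g) :
    ∀ᵐ t ∂ν, g t ≤ f t := by
  have key : ∀ q : ℚ, ∀ᵐ t ∂ν, f t ≤ q → g t ≤ q := by
    intro q
    have hmeas : ν (g ⁻¹' Iic (q : ℝ)) = ν (f ⁻¹' Iic (q : ℝ)) := by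
      rw [← Measure.map_apply hg measurableSet_Iic, ← hfg, Measure.map_apply hf measurableSet_Iic]
    by_cases hex : ∃ s ∈ S, f s ≤ q ∧ (q : ℝ) < g s
    · obtain ⟨s, hsS, hfs, hgs⟩ := hex
      have hsub : (g ⁻¹' Iic (q : ℝ) : Set ℝ) ≤ᵐ[ν] f ⁻¹' Iic (q : ℝ) := by
        filter_upwards [hS] with t ht hgt
        have hts : t ≤ s := le_of_not_gt fun hst =>
          absurd (hgS hsS ht hst.le) (not_le.2 (lt_of_le_of_lt hgt hgs))
        exact (hfS ht hsS hts).trans hfs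
      have := ae_eq_of_ae_subset_of_measure_ge hsub hmeas.ge
        (hg measurableSet_Iic).nullMeasurableSet (measure_ne_top _ _)
      filter_upwards [this] with t ht hft
      exact (Eq.mpr ht hft : t ∈ g ⁻¹' Iic (q : ℝ))
    · push Not at hex
      filter_upwards [hS] with t ht hft
      exact hex t ht hft
  filter_upwards [ae_all_iff.2 key] with t ht
  by_contra! hlt
  obtain ⟨q, hq1, hq2⟩ := exists_rat_btwn hlt
  exact absurd (ht q hq1.le) (not_le.2 hq2)

lemma ae_eq_of_map_eq_of_monotoneOn {ν : Measure ℝ} [IsFiniteMeasure ν] {f g : ℝ → ℝ}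
    (hf : Measurable f) (hg : Measurable g) {S : Set ℝ} (hS : ∀ᵐ t ∂ν, t ∈ S)
    (hfS : MonotoneOn f S) (hgS : MonotoneOn g S) (hfg : ν.map f = ν.map g) :
    f =ᵐ[ν] g := by
  filter_upwards [ae_le_of_map_eq_of_monotoneOn hf hg hS hfS hgS hfg,
    ae_le_of_map_eq_of_monotoneOn hg hf hS hgS hfS hfg.symm] with t h1 h2
  exact le_antisymm h2 h1

section

variable {N : ℕ} {μ : Measure (Fin N → ℝ)} {T Q : (Fin N → ℝ) → Fin N → ℝ}

lemma Triangular.map_restr_prod (hT : Measurable T) (htri : Triangular T)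
    (hpush : (lambdaN N).map T = μ) (k : Fin N) :
    μ.map (fun x => (restr k x, x k)) =
      ((lambdaN k).prod lambda01).map fun p => (head T k p.1, component T k p) := by
  have hpair : Measurable fun x : Fin N → ℝ => (restr k x, x k) :=
    (measurable_restr k).prodMk (measurable_pi_apply k)
  have hcomp : Measurable fun p => (head T k p.1, component T k p) :=
    ((measurable_head hT k).comp measurable_fst).prodMk (measurable_component hT k)
  rw [← hpush, ← lambdaN_map_restr_prod, Measure.map_map hpair hT, Measure.map_map hcomp hpair]
  congr 1
  ext1 u
  simp [htri.head_restr, htri.component_restr]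

lemma Triangular.map_restr (hT : Measurable T) (htri : Triangular T)
    (hpush : (lambdaN N).map T = μ) (k : Fin N) :
    μ.map (restr k) = (lambdaN k).map (head T k) := by
  rw [← hpush, ← lambdaN_map_restr, Measure.map_map (measurable_restr k) hT,
    Measure.map_map (measurable_head hT k) (measurable_restr k)]
  congr 1
  ext1 u
  exact (htri.head_restr k u).symm

lemma Triangular.ae_map_component_eq (hT : Measurable T) (htri : Triangular T)
    (hpush : (lambdaN N).map T = μ) {k : Fin N} {κ : Kernel (Fin (k : ℕ) → ℝ) ℝ}
    [IsMarkovKernel κ] (hκ : Disintegrates (μ.map fun x => (restr k x, x k)) κ)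
    {S : Set (Fin (k : ℕ) → ℝ)} (hS : ∀ᵐ a ∂lambdaN k, a ∈ S) (hinj : InjOn (head T k) S) :
    ∀ᵐ a ∂lambdaN k, lambda01.map (fun t => component T k (a, t)) = κ (head T k a) :=
  ae_map_eq_of_disintegrates_of_injOn (measurable_head hT k) (measurable_component hT k)
    (htri.map_restr_prod hT hpush k ▸ hκ) hS hinj

lemma IsQuantileProcess.monotoneOn_component (hQ : IsQuantileProcess Q) {k : Fin N}
    {a : Fin (k : ℕ) → ℝ} (ha : a ∈ cube k) :
    MonotoneOn (fun t => component Q k (a, t)) (Ioo 0 1) := by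
  intro s hs t ht hst
  refine hQ.inc k _ (extendPoint_mem_cube ha hs) _ (extendPoint_mem_cube ha ht)
    (fun j hj => ?_) (by simpa using hst)
  rw [extendPoint_of_lt hj, extendPoint_of_lt hj]

lemma IsQuantileProcess.strictMonoOn_component (hQ : IsQuantileProcess Q) {k : Fin N}
    {a : Fin (k : ℕ) → ℝ} (ha : a ∈ cube k)
    (hatom : ∀ x, lambda01.map (fun t => component Q k (a, t)) {x} = 0) :
    StrictMonoOn (fun t => component Q k (a, t)) (Ioo 0 1) :=
  .of_map_lambda01_singleton ((measurable_component hQ.measurable k).comp measurable_prodMk_left)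
    (hQ.monotoneOn_component ha) hatom

/-- The points of the cube at which no component of `Q` preceding the `k`-th one has a
conditional law with atoms. -/
def atomlessSet (Q : (Fin N → ℝ) → Fin N → ℝ) (k : Fin N) : Set (Fin (k : ℕ) → ℝ) :=
  {a | a ∈ cube k ∧ ∀ j < k, ∀ x,
    lambda01.map (fun t => component Q j (restr j (extendPoint k a (1 / 2)), t)) {x} = 0}

lemma IsQuantileProcess.injOn_head (hQ : IsQuantileProcess Q) (k : Fin N) :
    InjOn (head Q k) (atomlessSet Q k) := by
  rintro a ⟨ha, hatom⟩ b ⟨hb, -⟩ hab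
  set u := extendPoint k a (1 / 2) with hu
  set v := extendPoint k b (1 / 2) with hv
  have hhalf : (1 / 2 : ℝ) ∈ Ioo (0 : ℝ) 1 := by norm_num
  have huc : u ∈ cube N := extendPoint_mem_cube ha hhalf
  have hvc : v ∈ cube N := extendPoint_mem_cube hb hhalf
  have huv : ∀ j : Fin N, j < k → u j = v j := by
    intro j
    induction j using WellFoundedLT.induction with
    | ind j ih =>
      intro hj
      have hrestr : restr j u = restr j v := funext fun i => ih _ i.isLt (lt_trans i.isLt hj)
      refine (hQ.strictMonoOn_component (restr_mem_cube j huc) (hatom j hj)).injOn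
        (huc j) (hvc j) ?_
      rw [hQ.triangular.component_restr, hrestr, hQ.triangular.component_restr]
      exact congrFun hab ⟨j, hj⟩
  ext i
  have h := huv ⟨i, i.isLt.trans k.isLt⟩ i.isLt
  rwa [hu, hv, extendPoint_of_lt, extendPoint_of_lt] at h

lemma lambdaN_map_restr_extendPoint {j k : Fin N} (hjk : j < k) :
    (lambdaN k).map (fun a => restr j (extendPoint k a (1 / 2))) = lambdaN j := by
  have h : (fun a : Fin (k : ℕ) → ℝ => restr j (extendPoint k a (1 / 2))) =
      fun a i => a (Fin.castLE (Fin.le_of_lt hjk) i) := by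
    ext a i
    exact extendPoint_of_lt (j := ⟨i, i.isLt.trans j.isLt⟩) (lt_trans i.isLt hjk) a _
  rw [h]
  exact lambdaN_map_reindex (Fin.castLE_injective _)

lemma ae_mem_atomlessSet {k : Fin N}
    (h : ∀ j < k, ∀ᵐ a ∂lambdaN j, ∀ x, lambda01.map (fun t => component Q j (a, t)) {x} = 0) :
    ∀ᵐ a ∂lambdaN k, a ∈ atomlessSet Q k := by
  refine (ae_mem_cube k).and (ae_all_iff.2 fun j => ?_)
  by_cases hj : j < k
  · have hm : Measurable fun a => restr j (extendPoint k a (1 / 2)) :=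
      (measurable_restr j).comp ((measurable_extendPoint k).comp
        (measurable_id.prodMk measurable_const))
    have h' := ae_of_ae_map hm.aemeasurable (lambdaN_map_restr_extendPoint hj ▸ h j hj)
    exact h'.mono fun a ha _ => ha
  · exact .of_forall fun a hj' => absurd hj' hj

lemma IsQuantileProcess.ae_atomless (hQ : IsQuantileProcess Q) (hpush : (lambdaN N).map Q = μ)
    (hreg : TriangularRegular μ) (k : Fin N) :
    ∀ᵐ a ∂lambdaN k, ∀ x, lambda01.map (fun t => component Q k (a, t)) {x} = 0 := by
  induction k using WellFoundedLT.induction with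
  | ind k ih =>
    obtain ⟨κ, hκm, hκ, hatom⟩ := hreg k
    rw [hQ.triangular.map_restr hQ.measurable hpush] at hatom
    filter_upwards [hQ.triangular.ae_map_component_eq hQ.measurable hpush hκ
      (ae_mem_atomlessSet ih) (hQ.injOn_head k),
      ae_of_ae_map (measurable_head hQ.measurable k).aemeasurable hatom] with a ha hx
    rwa [ha]

lemma IsQuantileProcess.strictlyIncreasingTriangular (hQ : IsQuantileProcess Q)
    (hpush : (lambdaN N).map Q = μ) (hreg : TriangularRegular μ) :
    StrictlyIncreasingTriangular Q := by
  refine ⟨hQ.measurable, hQ.triangular, {u | u ∈ cube N ∧ ∀ k x,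
    lambda01.map (fun t => component Q k (restr k u, t)) {x} = 0}, fun u hu => hu.1, ?_, ?_⟩
  · refine ae_iff.1 ((ae_mem_cube N).and (ae_all_iff.2 fun k => ?_))
    refine ae_of_ae_map (measurable_restr k).aemeasurable ?_
      (p := fun a => ∀ x, lambda01.map (fun t => component Q k (a, t)) {x} = 0)
    rw [lambdaN_map_restr]
    exact hQ.ae_atomless hpush hreg k
  · rintro k u ⟨hu, hatom⟩ v ⟨hv, -⟩ huv hlt
    have hrestr : restr k u = restr k v := funext fun i => huv _ i.isLt
    have h := hQ.strictMonoOn_component (restr_mem_cube k hu) (hatom k) (hu k) (hv k) hlt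
    change component Q k (restr k u, u k) < component Q k (restr k u, v k) at h
    rwa [hQ.triangular.component_restr, hrestr, hQ.triangular.component_restr] at h

lemma ae_ae_update {k : Fin N} {p : (Fin N → ℝ) → Prop} (h : ∀ᵐ u ∂lambdaN N, p u) :
    ∀ᵐ u ∂lambdaN N, ∀ᵐ t ∂lambda01, p (Function.update u k t) := by
  rw [← lambdaN_map_update k] at h
  exact Measure.ae_ae_of_ae_prod (ae_of_ae_map (measurable_update_prod k).aemeasurable h)

lemma ae_of_ae_ae_update {k : Fin N} {p : (Fin N → ℝ) → Prop} (hp : MeasurableSet {u | p u})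
    (h : ∀ᵐ u ∂lambdaN N, ∀ᵐ t ∂lambda01, p (Function.update u k t)) :
    ∀ᵐ u ∂lambdaN N, p u := by
  rw [← lambdaN_map_update k, ae_map_iff (measurable_update_prod k).aemeasurable hp]
  exact (Measure.ae_prod_iff_ae_ae (measurable_update_prod k hp)).2 h

lemma IsQuantileProcess.ae_apply_eq (hQ : IsQuantileProcess Q)
    (hpush : (lambdaN N).map Q = μ) (hreg : TriangularRegular μ) (hT : IncreasingTriangular T)
    (hTpush : (lambdaN N).map T = μ) (k : Fin N) :
    ∀ᵐ u ∂lambdaN N, T u k = Q u k := by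
  obtain ⟨hTm, htri, Γ, -, hΓ, hinc⟩ := hT
  induction k using WellFoundedLT.induction with
  | ind k ih =>
    obtain ⟨κ, hκm, hκ, -⟩ := hreg k
    have hS := ae_mem_atomlessSet (k := k) fun j _ => hQ.ae_atomless hpush hreg j
    have hhead : ∀ᵐ a ∂lambdaN k, head T k a = head Q k a := by
      rw [← lambdaN_map_restr, ae_map_iff (measurable_restr k).aemeasurable
        (measurableSet_eq_fun (measurable_head hTm k) (measurable_head hQ.measurable k))]
      have : ∀ᵐ u ∂lambdaN N, ∀ j, j < k → T u j = Q u j := by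
        refine ae_all_iff.2 fun j => ?_
        by_cases hj : j < k
        · exact (ih j hj).mono fun _ h _ => h
        · exact .of_forall fun _ h => absurd h hj
      filter_upwards [this] with u hu
      rw [htri.head_restr, hQ.triangular.head_restr]
      exact funext fun i => hu _ i.isLt
    have hinj : InjOn (head T k) (atomlessSet Q k ∩ {a | head T k a = head Q k a}) :=
      ((hQ.injOn_head k).mono inter_subset_left).congr fun a ha => ha.2.symm
    have hmap : ∀ᵐ a ∂lambdaN k, lambda01.map (fun t => component T k (a, t)) =
        lambda01.map (fun t => component Q k (a, t)) := by
      filter_upwards [htri.ae_map_component_eq hTm hTpush hκ (hS.and hhead) hinj,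
        hQ.triangular.ae_map_component_eq hQ.measurable hpush hκ hS (hQ.injOn_head k),
        hhead] with a h1 h2 h3
      rw [h1, h2, h3]
    rw [← lambdaN_map_restr] at hmap
    have hΓ' : ∀ᵐ u ∂lambdaN N, u ∈ Γ := hΓ
    refine ae_of_ae_ae_update (k := k) (measurableSet_eq_fun
      ((measurable_pi_apply k).comp hTm) ((measurable_pi_apply k).comp hQ.measurable)) ?_
    filter_upwards [ae_of_ae_map (measurable_restr k).aemeasurable hmap,
      ae_ae_update (k := k) hΓ', ae_mem_cube N] with u hu huΓ hucube
    have hcomp := ae_eq_of_map_eq_of_monotoneOn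
      ((measurable_component hTm k).comp measurable_prodMk_left)
      ((measurable_component hQ.measurable k).comp measurable_prodMk_left)
      (huΓ.and ae_lambda01_mem) (S := {t | Function.update u k t ∈ Γ ∧ t ∈ Ioo 0 1})
      ?_ ((hQ.monotoneOn_component (restr_mem_cube k hucube)).mono fun t ht => ht.2) hu
    · filter_upwards [hcomp] with t ht
      change component T k (restr k u, t) = component Q k (restr k u, t) at ht
      rwa [htri.component_restr_update, hQ.triangular.component_restr_update] at ht
    · intro s hs t ht hst
      change component T k (restr k u, s) ≤ component T k (restr k u, t)
      rw [htri.component_restr_update, htri.component_restr_update]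
      refine hinc k _ hs.1 _ ht.1 (fun j hj => ?_) (by simpa using hst)
      rw [Function.update_of_ne hj.ne, Function.update_of_ne hj.ne]

end

/-- If `μ` is triangular regular, then its quantile process is strictly
triangular increasing, and it is the unique increasing triangular map pushing `λ^N` to `μ`. -/
theorem quantileProcess_of_triangularRegular (N : ℕ) (μ : Measure (Fin N → ℝ))
    [IsProbabilityMeasure μ] (hreg : TriangularRegular μ)
    (Q : (Fin N → ℝ) → Fin N → ℝ) (hQ : IsQuantileProcess Q)
    (hpush : (lambdaN N).map Q = μ) :
    StrictlyIncreasingTriangular Q ∧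
    ∀ T : (Fin N → ℝ) → Fin N → ℝ, IncreasingTriangular T → (lambdaN N).map T = μ →
      T =ᵐ[lambdaN N] Q := by
  refine ⟨hQ.strictlyIncreasingTriangular hpush hreg, fun T hT hTpush => ?_⟩
  filter_upwards [ae_all_iff.2 (hQ.ae_apply_eq hpush hreg hT hTpush)] with u hu
  exact funext hu
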